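/- For every integer g ≥ 2 and every integer k ≥ 1, there exist primes q_1 < q_2 < ⋯ < q_k, each exceeding max(g, k), such that s_g(q_1) > s_g(q_2) > ⋯ > s_g(q_k); that is, one can find k increasing primes, all larger than both g and k, whose base-g digit sums are strictly decreasing. -/

import Mathlib

/-- elementary symmetric sums over a finset -/
noncomputable def esy (x : ℕ → ℝ) (P : Finset ℕ) (j : ℕ) : ℝ :=
  ∑ d ∈ P.powersetCard j, ∏ p ∈ d, x p

lemma esy_zero (x : ℕ → ℝ) (P : Finset ℕ) : esy x P 0 = 1 := by simp [esy]

lemma esy_insert (x : ℕ → ℝ) (P : Finset ℕ) (a : ℕ) (ha : a ∉ P) (j : ℕ) :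
    esy x (insert a P) (j+1) = esy x P (j+1) + x a * esy x P j := by
  unfold esy
  rw [Finset.powersetCard_succ_insert ha, Finset.sum_union, Finset.sum_image, Finset.mul_sum]
  · congr 1
    refine Finset.sum_congr rfl fun d hd => ?_
    rw [Finset.prod_insert]
    exact fun h => ha ((Finset.mem_powersetCard.1 hd).1 h)
  · intro d hd e he h
    have h1 : a ∉ d := fun h => ha ((Finset.mem_powersetCard.1 hd).1 h)
    have h2 : a ∉ e := fun h => ha ((Finset.mem_powersetCard.1 he).1 h)
    rw [← Finset.erase_insert h1, ← Finset.erase_insert h2, h]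
  · rw [Finset.disjoint_left]
    intro d hd he
    obtain ⟨e, he, rfl⟩ := Finset.mem_image.1 he
    exact ha ((Finset.mem_powersetCard.1 hd).1 (Finset.mem_insert_self _ _))

lemma esy_le (x : ℕ → ℝ) (P : Finset ℕ) (hx : ∀ p ∈ P, 0 ≤ x p) (j : ℕ) :
    (j.factorial : ℝ) * esy x P j ≤ (∑ p ∈ P, x p) ^ j := by
  induction P using Finset.induction_on generalizing j with
  | empty =>
    cases j with
    | zero => simp [esy]
    | succ j =>
      have : (∅ : Finset ℕ).powersetCard (j+1) = ∅ := Finset.powersetCard_eq_empty.2 (by simp)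
      simp [esy, this]
  | insert a P ha ih =>
    cases j with
    | zero => simp [esy_zero]
    | succ j =>
      have ih' := ih (fun p hp => hx p (Finset.mem_insert_of_mem hp))
      have hxa := hx a (Finset.mem_insert_self _ _)
      have hS : 0 ≤ ∑ p ∈ P, x p := Finset.sum_nonneg fun p hp => hx p (Finset.mem_insert_of_mem hp)
      rw [esy_insert _ _ _ ha, Finset.sum_insert ha]
      set S := ∑ p ∈ P, x p
      have h1 := ih' (j+1)
      have h2 := ih' j
      have h3 : S^(j+1) + (j+1) * x a * S^j ≤ (x a + S)^(j+1) := by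
        have := pow_add_mul_le_add_pow_of_sq_nonneg (a := S) (b := x a) hS (by positivity)
          (by positivity) (by positivity) (j+1)
        rw [add_comm (x a) S]
        simp at this
        linarith
      rw [Nat.factorial_succ] at h1 ⊢
      push_cast at h1 ⊢
      have h4 := mul_le_mul_of_nonneg_left h2 (mul_nonneg (by positivity : (0:ℝ) ≤ j+1) hxa)
      linarith

/-- truncated inclusion–exclusion -/
noncomputable def trunc (x : ℕ → ℝ) (P : Finset ℕ) (t : ℕ) : ℝ :=
  ∑ j ∈ Finset.range (t+1), (-1)^j * esy x P j

lemma trunc_insert (x : ℕ → ℝ) (P : Finset ℕ) (a : ℕ) (ha : a ∉ P) (t : ℕ) :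
    trunc x (insert a P) (t+1) = trunc x P (t+1) - x a * trunc x P t := by
  unfold trunc
  rw [Finset.sum_range_succ', Finset.sum_range_succ' _ (t+1)]
  simp only [esy_insert _ _ _ ha, esy_zero, Finset.mul_sum]
  rw [add_sub_right_comm, ← Finset.sum_sub_distrib]
  congr 1
  refine Finset.sum_congr rfl fun j _ => ?_
  ring

lemma bonferroni (x : ℕ → ℝ) (P : Finset ℕ) (hx : ∀ p ∈ P, 0 ≤ x p ∧ x p ≤ 1) (t : ℕ) :
    0 ≤ (-1)^t * (trunc x P t - ∏ p ∈ P, (1 - x p)) := by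
  induction P using Finset.induction_on generalizing t with
  | empty =>
    have : trunc x ∅ t = 1 := by
      unfold trunc
      rw [Finset.sum_range_succ']
      have : ∀ j, (∅ : Finset ℕ).powersetCard (j+1) = ∅ :=
        fun j => Finset.powersetCard_eq_empty.2 (by simp)
      simp [esy, this]
    simp [this]
  | insert a P ha ih =>
    have ih' := ih (fun p hp => hx p (Finset.mem_insert_of_mem hp))
    have hxa := hx a (Finset.mem_insert_self _ _)
    cases t with
    | zero =>
      have : ∏ p ∈ insert a P, (1 - x p) ≤ 1 :=
        Finset.prod_le_one (fun p hp => by linarith [(hx p hp).2]) (fun p hp => by linarith [(hx p hp).1])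
      simp [trunc, esy_zero, this]
    | succ t =>
      rw [trunc_insert _ _ _ ha, Finset.prod_insert ha]
      have h1 := ih' (t+1)
      have h2 := mul_nonneg hxa.1 (ih' t)
      have : (-1:ℝ)^(t+1) * (trunc x P (t+1) - x a * trunc x P t - (1 - x a) * ∏ p ∈ P, (1 - x p))
        = (-1)^(t+1) * (trunc x P (t+1) - ∏ p ∈ P, (1 - x p)) +
          x a * ((-1)^t * (trunc x P t - ∏ p ∈ P, (1 - x p))) := by ring
      rw [this]; linarith

/-- CRT count -/
lemma crt_count (Y : ℕ) (a b : ℕ → ℕ) (d : Finset ℕ) (hd : ∀ p ∈ d, p.Prime)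
    (hab : ∀ p ∈ d, ¬ a p ≡ b p [MOD p]) (q c : ℕ) (hq : 0 < q) (hco : ∀ p ∈ d, q.Coprime p) :
    |(((Finset.range Y).filter (fun n => n ≡ c [MOD q] ∧
        ∀ p ∈ d, n ≡ a p [MOD p] ∨ n ≡ b p [MOD p])).card : ℝ)
      - Y / q * ∏ p ∈ d, (2 / p : ℝ)| ≤ 2 ^ d.card := by
  induction d using Finset.induction_on generalizing q c with
  | empty =>
    simp only [Finset.notMem_empty, false_imp_iff, implies_true, and_true, Finset.prod_empty,
      Finset.card_empty, pow_zero, mul_one]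
    have h := Nat.count_modEq_card Y hq c
    rw [Nat.count_eq_card_filter_range] at h
    rw [h]
    have h1 : (Y:ℝ) / q = (Y / q : ℕ) + ((Y % q : ℕ) : ℝ) / q := by
      have : (q:ℝ) ≠ 0 := by positivity
      field_simp
      exact_mod_cast (Nat.div_add_mod Y q).symm
    have h2 : ((Y % q : ℕ) : ℝ) / q < 1 := by
      rw [div_lt_one (by positivity)]
      exact_mod_cast Nat.mod_lt _ hq
    have h3 : 0 ≤ ((Y % q : ℕ) : ℝ) / q := by positivity
    rw [h1, abs_le]
    push_cast
    split_ifs <;> constructor <;> push_cast <;> linarith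
  | insert p d hp ih =>
    have hpp := hd p (Finset.mem_insert_self _ _)
    have hqp : q.Coprime p := hco p (Finset.mem_insert_self _ _)
    have key : ∀ r, ∃ c', ∀ n, (n ≡ c [MOD q] ∧ n ≡ r [MOD p]) ↔ n ≡ c' [MOD q * p] := by
      intro r
      refine ⟨Nat.chineseRemainder hqp c r, fun n => ?_⟩
      have h := (Nat.chineseRemainder hqp c r).2
      rw [← Nat.modEq_and_modEq_iff_modEq_mul hqp]
      constructor
      · rintro ⟨h1, h2⟩; exact ⟨h1.trans h.1.symm, h2.trans h.2.symm⟩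
      · rintro ⟨h1, h2⟩; exact ⟨h1.trans h.1, h2.trans h.2⟩
    obtain ⟨c1, hc1⟩ := key (a p)
    obtain ⟨c2, hc2⟩ := key (b p)
    have ih' := fun c => ih (fun p hp => hd p (Finset.mem_insert_of_mem hp))
      (fun p hp => hab p (Finset.mem_insert_of_mem hp)) (q*p) c (by have := hpp.pos; positivity)
      (fun p' hp' => Nat.Coprime.mul_left (hco p' (Finset.mem_insert_of_mem hp'))
        ((Nat.coprime_primes hpp (hd p' (Finset.mem_insert_of_mem hp'))).2 (by rintro rfl; exact hp hp')))
    have h1 := ih' c1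
    have h2 := ih' c2
    have hcard : ((Finset.range Y).filter (fun n => n ≡ c [MOD q] ∧
        ∀ p' ∈ insert p d, n ≡ a p' [MOD p'] ∨ n ≡ b p' [MOD p'])).card =
        ((Finset.range Y).filter (fun n => n ≡ c1 [MOD q * p] ∧
        ∀ p ∈ d, n ≡ a p [MOD p] ∨ n ≡ b p [MOD p])).card +
        ((Finset.range Y).filter (fun n => n ≡ c2 [MOD q * p] ∧
        ∀ p ∈ d, n ≡ a p [MOD p] ∨ n ≡ b p [MOD p])).card := by
      rw [← Finset.card_union_of_disjoint]
      · congr 1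
        ext n
        simp only [Finset.mem_filter, Finset.mem_union, Finset.forall_mem_insert, ← hc1, ← hc2]
        tauto
      · rw [Finset.disjoint_left]
        intro n hn hn'
        simp only [Finset.mem_filter, ← hc1, ← hc2] at hn hn'
        exact hab p (Finset.mem_insert_self _ _) (hn.2.1.2.symm.trans hn'.2.1.2)
    rw [hcard, Finset.prod_insert hp, Finset.card_insert_of_notMem hp, pow_succ]
    have hp0 : (p:ℝ) ≠ 0 := by exact_mod_cast hpp.ne_zero
    have hq0 : (q:ℝ) ≠ 0 := by positivity
    have e : (Y:ℝ) / q * (2 / p * ∏ p ∈ d, (2 / p : ℝ)) =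
      Y / (q * p : ℕ) * (∏ p ∈ d, (2 / p : ℝ)) + Y / (q * p : ℕ) * (∏ p ∈ d, (2 / p : ℝ)) := by
      push_cast; field_simp; ring
    rw [e]
    rw [abs_le] at h1 h2 ⊢
    push_cast at *
    constructor <;> linarith [h1.1, h1.2, h2.1, h2.2]

lemma esy_const_le (P : Finset ℕ) (t : ℕ) :
    ∑ j ∈ Finset.range (t+1), ∑ d ∈ P.powersetCard j, (2:ℝ)^d.card ≤ (2 * P.card + 1)^t := by
  have h : ∀ j, ∑ d ∈ P.powersetCard j, (2:ℝ)^d.card ≤ (2 * P.card)^j := by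
    intro j
    rw [Finset.sum_congr rfl (fun d hd => by rw [(Finset.mem_powersetCard.1 hd).2])]
    rw [Finset.sum_const, Finset.card_powersetCard, nsmul_eq_mul, mul_pow, mul_comm]
    gcongr
    exact_mod_cast Nat.choose_le_pow _ _
  refine (Finset.sum_le_sum fun j _ => h j).trans ?_
  have hm : (0:ℝ) ≤ 2 * P.card := by positivity
  generalize (2 * (P.card:ℝ)) = m at *
  clear h
  induction t with
  | zero => simp
  | succ t ih =>
    rw [Finset.sum_range_succ]
    have : m^(t+1) ≤ m * (m+1)^t := by
      rw [pow_succ, mul_comm]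
      gcongr
      linarith
    calc _ ≤ (m+1)^t + m * (m+1)^t := add_le_add ih this
      _ = (m+1)^(t+1) := by ring

lemma sieve_bound (Y : ℕ) (a b : ℕ → ℕ) (P : Finset ℕ) (hP : ∀ p ∈ P, p.Prime)
    (hab : ∀ p ∈ P, ¬ a p ≡ b p [MOD p]) (t : ℕ) (ht : Even t) :
    (((Finset.range Y).filter (fun n =>
        ∀ p ∈ P, ¬ (n ≡ a p [MOD p] ∨ n ≡ b p [MOD p]))).card : ℝ) ≤
      Y * (∏ p ∈ P, (1 - 2 / p : ℝ) + (∑ p ∈ P, (2 / p : ℝ))^(t+1) / (t+1).factorial)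
        + (2 * P.card + 1)^t := by
  classical
  let x : ℕ → ℕ → ℝ := fun n p => if (n ≡ a p [MOD p] ∨ n ≡ b p [MOD p]) then 1 else 0
  have hx : ∀ n p, 0 ≤ x n p ∧ x n p ≤ 1 := by
    intro n p; simp only [x]; split_ifs <;> norm_num
  have h1 : (((Finset.range Y).filter (fun n =>
        ∀ p ∈ P, ¬ (n ≡ a p [MOD p] ∨ n ≡ b p [MOD p]))).card : ℝ) ≤
        ∑ n ∈ Finset.range Y, trunc (x n) P t := by
    rw [Finset.card_filter]
    push_cast
    refine Finset.sum_le_sum fun n _ => ?_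
    have := bonferroni (x n) P (fun p _ => hx n p) t
    rw [ht.neg_one_pow, one_mul] at this
    refine le_trans ?_ (sub_nonneg.1 this)
    split_ifs with h
    · rw [Finset.prod_eq_one]
      intro p hp
      simp only [x]
      rw [if_neg (h p hp)]; simp
    · exact Finset.prod_nonneg fun p _ => by linarith [(hx n p).2]
  have h2 : ∑ n ∈ Finset.range Y, trunc (x n) P t =
      ∑ j ∈ Finset.range (t+1), ∑ d ∈ P.powersetCard j, (-1:ℝ)^j *
        ((Finset.range Y).filter (fun n =>
          ∀ p ∈ d, (n ≡ a p [MOD p] ∨ n ≡ b p [MOD p]))).card := by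
    unfold trunc esy
    rw [Finset.sum_comm]
    refine Finset.sum_congr rfl fun j _ => ?_
    rw [← Finset.mul_sum, ← Finset.mul_sum, Finset.sum_comm]
    congr 1
    refine Finset.sum_congr rfl fun d _ => ?_
    rw [Finset.card_filter]
    push_cast
    refine Finset.sum_congr rfl fun n _ => ?_
    simp only [x]
    rw [Finset.prod_ite_zero]
    simp
  have h3 : ∀ j, ∀ d ∈ P.powersetCard j, (-1:ℝ)^j *
        ((Finset.range Y).filter (fun n =>
          ∀ p ∈ d, (n ≡ a p [MOD p] ∨ n ≡ b p [MOD p]))).card ≤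
        Y * ((-1:ℝ)^j * ∏ p ∈ d, (2 / p : ℝ)) + 2 ^ d.card := by
    intro j d hd
    have hdP := (Finset.mem_powersetCard.1 hd).1
    have := crt_count Y a b d (fun p hp => hP p (hdP hp)) (fun p hp => hab p (hdP hp)) 1 0 one_pos
      (fun p _ => Nat.coprime_one_left p)
    simp only [Nat.modEq_one, true_and, Nat.cast_one, div_one] at this
    rw [abs_le] at this
    rcases neg_one_pow_eq_or ℝ j with h | h <;> rw [h] <;> linarith [this.1, this.2]
  have h4 : ∑ n ∈ Finset.range Y, trunc (x n) P t ≤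
      Y * trunc (fun p => 2 / p) P t + (2 * P.card + 1)^t := by
    rw [h2]
    refine (Finset.sum_le_sum fun j _ => Finset.sum_le_sum fun d hd => h3 j d hd).trans ?_
    simp only [Finset.sum_add_distrib]
    refine add_le_add (le_of_eq ?_) (esy_const_le P t)
    unfold trunc esy
    simp only [Finset.mul_sum]
  refine h1.trans (h4.trans ?_)
  gcongr
  have hx2 : ∀ p ∈ P, 0 ≤ (2 / p : ℝ) ∧ (2 / p : ℝ) ≤ 1 := by
    intro p hp
    have : (2:ℝ) ≤ p := by exact_mod_cast (hP p hp).two_le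
    exact ⟨by positivity, by rw [div_le_one (by linarith)]; exact this⟩
  have h5 := bonferroni (fun p => (2 / p : ℝ)) P hx2 (t+1)
  rw [ht.add_one.neg_one_pow] at h5
  have h6 : trunc (fun p => (2 / p : ℝ)) P (t+1) = trunc (fun p => (2 / p : ℝ)) P t -
      esy (fun p => (2 / p : ℝ)) P (t+1) := by
    unfold trunc
    rw [Finset.sum_range_succ _ (t+1), ht.add_one.neg_one_pow]
    ring
  have h7 := esy_le (fun p => (2 / p : ℝ)) P (fun p hp => (hx2 p hp).1) (t+1)
  have h8 : esy (fun p => (2 / p : ℝ)) P (t+1) ≤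
      (∑ p ∈ P, (2 / p : ℝ))^(t+1) / (t+1).factorial := by
    rw [le_div_iff₀ (by positivity)]; linarith
  linarith

open Chebyshev in
lemma sum_inv_primes_le (J : ℕ) (hJ : 1 ≤ J) :
    ∑ p ∈ (Finset.range (2^J+1)).filter Nat.Prime, (1 / p : ℝ) ≤ 5 + 4 * Real.log J := by
  have key : ∀ J : ℕ, ∑ p ∈ (Finset.range (2^(J+1)+1)).filter Nat.Prime, (1 / p : ℝ)
      ≤ 1/2 + 4 * (harmonic J : ℝ) := by
    intro J
    induction J with
    | zero =>
      have : (Finset.range (2^(0+1)+1)).filter Nat.Prime = {2} := by decide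
      rw [this]; simp
    | succ J ih =>
      rw [harmonic_succ]
      have hsplit : (Finset.range (2^(J+1+1)+1)).filter Nat.Prime =
        (Finset.range (2^(J+1)+1)).filter Nat.Prime ∪
        (Finset.Ioc (2^(J+1)) (2^(J+1+1))).filter Nat.Prime := by
        ext p
        simp only [Finset.mem_filter, Finset.mem_range, Finset.mem_union, Finset.mem_Ioc]
        have : 2^(J+1) ≤ 2^(J+1+1) := Nat.pow_le_pow_right (by norm_num) (by omega)
        constructor
        · rintro ⟨h1, h2⟩
          by_cases h : p < 2^(J+1)+1
          · exact Or.inl ⟨h, h2⟩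
          · exact Or.inr ⟨⟨by omega, by omega⟩, h2⟩
        · rintro (⟨h1, h2⟩ | ⟨⟨h1, h2⟩, h3⟩)
          · exact ⟨by omega, h2⟩
          · exact ⟨by omega, h3⟩
      have hdisj : Disjoint ((Finset.range (2^(J+1)+1)).filter Nat.Prime)
        ((Finset.Ioc (2^(J+1)) (2^(J+1+1))).filter Nat.Prime) := by
        rw [Finset.disjoint_left]
        intro p hp hp'
        simp only [Finset.mem_filter, Finset.mem_range, Finset.mem_Ioc] at hp hp'
        omega
      rw [hsplit, Finset.sum_union hdisj]
      have hl2 : 0 < Real.log 2 := Real.log_pos (by norm_num)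
      have hb : ∑ p ∈ (Finset.Ioc (2^(J+1)) (2^(J+1+1))).filter Nat.Prime, (1 / p : ℝ) ≤
          4 * (J+1:ℝ)⁻¹ := by
        have h1 : ∀ p ∈ (Finset.Ioc (2^(J+1)) (2^(J+1+1))).filter Nat.Prime, (1 / p : ℝ) ≤
            Real.log p / ((J+1) * Real.log 2 * 2^(J+1)) := by
          intro p hp
          simp only [Finset.mem_filter, Finset.mem_Ioc] at hp
          have hp1 : (2:ℝ)^(J+1) ≤ p := by exact_mod_cast hp.1.1.le
          have hp2 : (J+1) * Real.log 2 ≤ Real.log p := by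
            have := Real.log_le_log (by positivity) hp1
            rw [Real.log_pow] at this
            push_cast at this; exact this
          have hp0 : (0:ℝ) < p := lt_of_lt_of_le (by positivity) hp1
          rw [div_le_div_iff₀ hp0 (by positivity), one_mul]
          exact mul_le_mul hp2 hp1 (by positivity) (le_trans (by positivity) hp2)
        refine (Finset.sum_le_sum h1).trans ?_
        rw [← Finset.sum_div]
        have h2 : ∑ p ∈ (Finset.Ioc (2^(J+1)) (2^(J+1+1))).filter Nat.Prime, Real.log p ≤
            θ ((2^(J+1+1) : ℕ) : ℝ) := by
          rw [Chebyshev.theta, Nat.floor_natCast]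
          refine Finset.sum_le_sum_of_subset_of_nonneg ?_ ?_
          · intro p hp
            simp only [Finset.mem_filter, Finset.mem_Ioc] at hp ⊢
            exact ⟨⟨by omega, hp.1.2⟩, hp.2⟩
          · intro p hp _
            exact Real.log_natCast_nonneg p
        have h3 := theta_le_log4_mul_x (x := ((2^(J+1+1) : ℕ) : ℝ)) (by positivity)
        have h4 : Real.log 4 = 2 * Real.log 2 := by
          rw [show (4:ℝ) = 2^2 by norm_num, Real.log_pow]; norm_num
        rw [div_le_iff₀ (by positivity)]
        refine (h2.trans h3).trans (le_of_eq ?_)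
        rw [h4]; push_cast; field_simp; ring
      push_cast
      linarith
  obtain ⟨J, rfl⟩ : ∃ m, J = m + 1 := ⟨J - 1, by omega⟩
  refine (key J).trans ?_
  have h1 := harmonic_le_one_add_log J
  have h2 : Real.log J ≤ Real.log (J+1:ℕ) := by
    rcases Nat.eq_zero_or_pos J with rfl | h
    · simp
    · apply Real.log_le_log (by exact_mod_cast h) (by push_cast; linarith)
  linarith

lemma mertens_prod (z : ℕ) (hz : 1 ≤ z) :
    Real.log z ≤ ∏ p ∈ z.primesBelow, (1 - 1 / p : ℝ)⁻¹ := by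
  let f : ℕ →* ℝ := ⟨⟨fun n => (n:ℝ)⁻¹, by simp⟩, by intro a b; simp [mul_comm]⟩
  have hf : ∀ n, f n = (n:ℝ)⁻¹ := fun n => rfl
  have h := EulerProduct.summable_and_hasSum_smoothNumbers_prod_primesBelow_geometric (f := f)
    (by intro p hp
        rw [hf, norm_inv, Real.norm_natCast]
        exact inv_lt_one_of_one_lt₀ (by exact_mod_cast hp.one_lt)) z
  simp only [hf] at h
  simp only [one_div]
  rw [← h.2.tsum_eq]
  have h1 : Real.log z ≤ (harmonic (z-1) : ℝ) := by
    have := log_add_one_le_harmonic (z-1)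
    rwa [Nat.sub_add_cancel hz] at this
  refine h1.trans ?_
  have hmem : ∀ i ∈ Finset.range (z-1), i + 1 ∈ z.smoothNumbers := by
    intro i hi
    rw [Finset.mem_range] at hi
    apply Nat.mem_smoothNumbers_of_lt (by omega) (by omega)
  let s : Finset z.smoothNumbers := (Finset.range (z-1)).attach.map
    ⟨fun i => ⟨i.1+1, hmem i.1 i.2⟩, by
      intro a b h
      have h' := congrArg Subtype.val h
      simp only at h'
      exact Subtype.ext (by omega)⟩
  have h2 := h.2.summable.sum_le_tsum s (fun i _ => by positivity)
  refine le_trans (le_of_eq ?_) h2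
  have h3 := Finset.sum_attach (Finset.range (z-1)) (fun i => (((i+1:ℕ):ℝ))⁻¹)
  rw [Finset.sum_map]
  refine Eq.trans ?_ h3.symm
  simp [harmonic]

lemma one_sub_inv_le_exp (p : ℕ) (hp : 2 ≤ p) : (1 - 1 / p : ℝ)⁻¹ ≤ Real.exp (2 / p) := by
  have h2 : (2:ℝ) ≤ p := by exact_mod_cast hp
  have hp0 : (0:ℝ) < p := by linarith
  have h1 : (1 - 1 / p : ℝ)⁻¹ ≤ 1 + 2 / p := by
    rw [inv_le_comm₀ (by rw [sub_pos, div_lt_one hp0]; linarith) (by positivity), inv_eq_one_div,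
      div_le_iff₀ (by positivity)]
    have : (1 - 1 / (p:ℝ)) * (1 + 2 / p) - 1 = (p - 2) / p^2 := by field_simp; ring
    have : 0 ≤ ((p:ℝ) - 2) / p^2 := div_nonneg (by linarith) (by positivity)
    linarith
  exact h1.trans (by rw [add_comm]; exact Real.add_one_le_exp _)

lemma totient_loss (m K : ℕ) (hK : 1 ≤ K) (hm : m.primeFactors.card ≤ 2^K) :
    ∏ p ∈ m.primeFactors, (1 - 1 / p : ℝ)⁻¹ ≤ Real.exp 12 * (K:ℝ)^8 := by
  have h1 : ∏ p ∈ m.primeFactors, (1 - 1 / p : ℝ)⁻¹ ≤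
      Real.exp (∑ p ∈ m.primeFactors, (2 / p : ℝ)) := by
    rw [Real.exp_sum]
    refine Finset.prod_le_prod (fun p hp => ?_) (fun p hp => one_sub_inv_le_exp p (Nat.prime_of_mem_primeFactors hp).two_le)
    have : (2:ℝ) ≤ p := by exact_mod_cast (Nat.prime_of_mem_primeFactors hp).two_le
    rw [inv_nonneg, sub_nonneg, div_le_one (by linarith)]; linarith
  refine h1.trans ?_
  have hKr : (0:ℝ) < K := by exact_mod_cast hK
  have h2 : Real.exp 12 * (K:ℝ)^8 = Real.exp (12 + 8 * Real.log K) := by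
    rw [Real.exp_add]
    congr 1
    rw [show (8:ℝ) * Real.log K = ((8:ℕ):ℝ) * Real.log K by norm_num, ← Real.log_pow, Real.exp_log (by positivity)]
  rw [h2, Real.exp_le_exp, ← Finset.sum_filter_add_sum_filter_not _ (fun p => p ≤ 2^K)]
  have h3 : ∑ p ∈ m.primeFactors.filter (fun p => p ≤ 2^K), (2 / p : ℝ) ≤ 2 * (5 + 4 * Real.log K) := by
    refine le_trans ?_ (mul_le_mul_of_nonneg_left (sum_inv_primes_le K hK) (by norm_num))
    rw [Finset.mul_sum]
    simp only [mul_one_div]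
    refine Finset.sum_le_sum_of_subset_of_nonneg ?_ (fun _ _ _ => by positivity)
    intro p hp
    simp only [Finset.mem_filter, Finset.mem_range] at hp ⊢
    exact ⟨by omega, Nat.prime_of_mem_primeFactors hp.1⟩
  have h4 : ∑ p ∈ m.primeFactors.filter (fun p => ¬ p ≤ 2^K), (2 / p : ℝ) ≤ 2 := by
    calc _ ≤ ∑ p ∈ m.primeFactors.filter (fun p => ¬ p ≤ 2^K), (2 / 2^K : ℝ) := by
          refine Finset.sum_le_sum fun p hp => ?_
          simp only [Finset.mem_filter, not_le] at hp
          have : (2:ℝ)^K ≤ p := by exact_mod_cast hp.2.le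
          gcongr
      _ ≤ 2^K * (2/2^K : ℝ) := by
          rw [Finset.sum_const, nsmul_eq_mul]
          gcongr
          exact_mod_cast (Finset.card_filter_le _ _).trans hm
      _ = 2 := by field_simp
  linarith
open Polynomial

def dsum (g n : ℕ) : ℕ := (Nat.digits g n).sum

lemma dsum_add (g : ℕ) (hg : 2 ≤ g) (d n : ℕ) (hd : d < g) : dsum g (d + g * n) = d + dsum g n := by
  unfold dsum
  by_cases h : d = 0 ∧ n = 0
  · simp [h.1, h.2]
  · rw [Nat.digits_add g (by omega) d n hd (by by_contra h'; push Not at h'; exact h h')]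
    simp

lemma dsum_split (g : ℕ) (hg : 2 ≤ g) (r H L : ℕ) (hL : L < g^r) :
    dsum g (H * g^r + L) = dsum g H + dsum g L := by
  induction r generalizing L with
  | zero =>
    have : L = 0 := by simpa using hL
    subst this; simp [dsum]
  | succ r ih =>
    have hL' : L / g < g^r := by
      rw [Nat.div_lt_iff_lt_mul (by omega)]; rwa [pow_succ] at hL
    have hm : L % g < g := Nat.mod_lt _ (by omega)
    have e1 : L = L % g + g * (L / g) := (Nat.mod_add_div L g).symm
    have e2 : H * g^(r+1) + L = L % g + g * (H * g^r + L / g) := by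
      conv_lhs => rw [e1]
      ring
    rw [e2, dsum_add g hg _ _ hm, ih _ hL']
    conv_rhs => rw [e1, dsum_add g hg _ _ hm]
    ring

lemma dsum_le (g : ℕ) (hg : 2 ≤ g) (r L : ℕ) (hL : L < g^r) : dsum g L ≤ r * g := by
  induction r generalizing L with
  | zero =>
    have : L = 0 := by simpa using hL
    subst this; simp [dsum]
  | succ r ih =>
    have hL' : L / g < g^r := by
      rw [Nat.div_lt_iff_lt_mul (by omega)]; rwa [pow_succ] at hL
    have hm : L % g < g := Nat.mod_lt _ (by omega)
    have e1 : L = L % g + g * (L / g) := (Nat.mod_add_div L g).symm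
    rw [e1, dsum_add g hg _ _ hm]
    have := ih _ hL'
    nlinarith

lemma genfun (g : ℕ) (hg : 2 ≤ g) (r : ℕ) :
    ∑ L ∈ Finset.range (g^r), (X : ℕ[X])^(dsum g L) = (∑ d ∈ Finset.range g, X^d)^r := by
  induction r with
  | zero => simp [dsum]
  | succ r ih =>
    rw [pow_succ (∑ d ∈ Finset.range g, X^d), ← ih, Finset.sum_mul_sum, ← Finset.sum_product']
    symm
    refine Finset.sum_bij' (fun x _ => x.2 + g * x.1) (fun L _ => (L / g, L % g)) ?_ ?_ ?_ ?_ ?_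
    · rintro ⟨n, d⟩ h
      simp only [Finset.mem_product, Finset.mem_range] at h ⊢
      calc d + g * n < g + g * n := by omega
        _ = g * (n+1) := by ring
        _ ≤ g * g^r := Nat.mul_le_mul_left _ h.1
        _ = g^(r+1) := by ring
    · intro L hL
      simp only [Finset.mem_product, Finset.mem_range] at hL ⊢
      exact ⟨by rw [Nat.div_lt_iff_lt_mul (by omega)]; rwa [pow_succ] at hL, Nat.mod_lt _ (by omega)⟩
    · rintro ⟨n, d⟩ h
      simp only [Finset.mem_product, Finset.mem_range] at h ⊢
      rw [Nat.add_mul_div_left _ _ (by omega), Nat.div_eq_of_lt h.2, Nat.add_mul_mod_self_left, Nat.mod_eq_of_lt h.2]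
      simp
    · intro L hL
      exact Nat.mod_add_div L g
    · rintro ⟨n, d⟩ h
      simp only [Finset.mem_product, Finset.mem_range] at h ⊢
      rw [dsum_add g hg _ _ h.2, pow_add, mul_comm]

lemma choose_half (j : ℕ) : (j.choose (j/2))^2 * (j+1) ≤ 4^j := by
  have hc : ∀ m : ℕ, (Nat.centralBinom m)^2 * (2*m+1) ≤ 16^m := by
    intro m
    induction m with
    | zero => simp
    | succ m ih =>
      have h := Nat.succ_mul_centralBinom_succ m
      have : (m+1)^2 * ((Nat.centralBinom (m+1))^2 * (2*(m+1)+1)) ≤ (m+1)^2 * 16^(m+1) := by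
        calc (m+1)^2 * ((Nat.centralBinom (m+1))^2 * (2*(m+1)+1))
            = ((m+1) * Nat.centralBinom (m+1))^2 * (2*m+3) := by ring
          _ = (4 * (2*m+1) * (2*m+3)) * ((Nat.centralBinom m)^2 * (2*m+1)) := by rw [h]; ring
          _ ≤ ((m+1)^2 * 16) * 16^m := Nat.mul_le_mul (by nlinarith) ih
          _ = _ := by ring
      exact Nat.le_of_mul_le_mul_left this (by positivity)
  rcases Nat.even_or_odd' j with ⟨m, rfl | rfl⟩
  · rw [Nat.mul_div_cancel_left _ (by norm_num), ← Nat.centralBinom_eq_two_mul_choose, pow_mul]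
    exact hc m
  · have h1 : (2*m+1)/2 = m := by omega
    rw [h1]
    have h2 : Nat.centralBinom (m+1) = 2 * (2*m+1).choose m := by
      rw [Nat.centralBinom_eq_two_mul_choose, show 2*(m+1) = (2*m+1)+1 by ring, Nat.choose_succ_succ,
        Nat.choose_symm_half]
      ring
    have := hc (m+1)
    rw [h2] at this
    have e : (16:ℕ)^(m+1) = 4 * 4^(2*m+1) := by
      rw [show (16:ℕ) = 4^2 by norm_num, ← pow_mul]; ring
    rw [e] at this
    nlinarith

lemma coeff_le_eval (Q : ℕ[X]) (j w : ℕ) :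
    ((1+X)^j * Q).coeff w ≤ j.choose (j/2) * Q.eval 1 := by
  rw [Polynomial.coeff_mul]
  calc ∑ x ∈ Finset.HasAntidiagonal.antidiagonal w, ((1+X : ℕ[X])^j).coeff x.1 * Q.coeff x.2
      ≤ ∑ x ∈ Finset.HasAntidiagonal.antidiagonal w, j.choose (j/2) * Q.coeff x.2 := by
        refine Finset.sum_le_sum fun x _ => Nat.mul_le_mul_right _ ?_
        rw [Polynomial.coeff_one_add_X_pow]
        exact Nat.choose_le_middle _ _
    _ = j.choose (j/2) * ∑ i ∈ Finset.range (w+1), Q.coeff i := by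
        rw [← Finset.mul_sum, Finset.Nat.sum_antidiagonal_eq_sum_range_succ_mk]
        congr 1
        rw [← Finset.sum_range_reflect]
        refine Finset.sum_congr rfl fun i hi => ?_
        have hi' := Finset.mem_range.1 hi
        have e : w - (w + 1 - 1 - i) = i := by omega
        simp only [e]
    _ ≤ _ := by
        refine Nat.mul_le_mul_left _ ?_
        rw [Polynomial.eval_eq_sum_range' (n := max (w+1) (Q.natDegree+1)) (by omega)]
        simp only [one_pow, mul_one]
        exact Finset.sum_le_sum_of_subset (Finset.range_mono (le_max_left _ _))

lemma anticonc (g : ℕ) (hg : 2 ≤ g) (r w : ℕ) :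
    ((((Finset.range (g^r)).filter (fun L => dsum g L = w)).card : ℝ))^2 * (r+1) ≤ (g:ℝ)^(2*r+1) := by
  -- decomposition of the digit polynomial
  obtain ⟨q, u, hf⟩ : ∃ (q : ℕ[X]) (u : ℕ), (∑ d ∈ Finset.range g, (X:ℕ[X])^d) = (1+X) * q + C u ∧
      q.eval 1 ≠ 0 := by
    rcases Nat.even_or_odd' g with ⟨m, rfl | rfl⟩
    · refine ⟨∑ i ∈ Finset.range m, X^(2*i), 0, ?_, ?_⟩
      · clear hg
        induction m with
        | zero => simp
        | succ m ih =>
          rw [show 2*(m+1) = 2*m+1+1 by ring, Finset.sum_range_succ, Finset.sum_range_succ, ih,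
            Finset.sum_range_succ]
          simp; ring
      · simp [Polynomial.eval_finsetSum]; omega
    · refine ⟨∑ i ∈ Finset.range m, X^(2*i+1), 1, ?_, ?_⟩
      · clear hg
        induction m with
        | zero => simp
        | succ m ih =>
          rw [show 2*(m+1)+1 = 2*m+1+1+1 by ring, Finset.sum_range_succ, Finset.sum_range_succ, ih,
            Finset.sum_range_succ]
          simp; ring
      · simp [Polynomial.eval_finsetSum]; omega
  obtain ⟨hf, hq⟩ := hf
  set q1 := q.eval 1 with hq1
  have hgu : g = 2 * q1 + u := by
    have := congrArg (Polynomial.eval 1) hf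
    simp [Polynomial.eval_finsetSum] at this
    omega
  have hcard : ((Finset.range (g^r)).filter (fun L => dsum g L = w)).card =
      ((∑ d ∈ Finset.range g, (X:ℕ[X])^d)^r).coeff w := by
    rw [← genfun g hg r, Polynomial.finsetSum_coeff, Finset.card_filter]
    refine Finset.sum_congr rfl fun L _ => ?_
    rw [Polynomial.coeff_X_pow]
    simp [eq_comm]
  have hle : ((Finset.range (g^r)).filter (fun L => dsum g L = w)).card ≤
      ∑ j ∈ Finset.range (r+1), j.choose (j/2) * (q1^j * u^(r-j) * r.choose j) := by
    rw [hcard, hf, add_pow, Polynomial.finsetSum_coeff]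
    refine Finset.sum_le_sum fun j _ => ?_
    have e : ((1+X) * q)^j * (C u)^(r-j) * ((r.choose j : ℕ) : ℕ[X]) =
        (1+X)^j * (q^j * (C u)^(r-j) * ((r.choose j : ℕ) : ℕ[X])) := by
      rw [mul_pow]; ring
    rw [e]
    refine (coeff_le_eval _ _ _).trans (le_of_eq ?_)
    simp [hq1]
  have hle' : (((Finset.range (g^r)).filter (fun L => dsum g L = w)).card : ℝ) ≤
      ∑ j ∈ Finset.range (r+1), (j.choose (j/2) : ℝ) * (q1^j * u^(r-j) * r.choose j) := by
    exact_mod_cast hle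
  have hnn : (0:ℝ) ≤ ∑ j ∈ Finset.range (r+1), (j.choose (j/2) : ℝ) * (q1^j * u^(r-j) * r.choose j) := by
    positivity
  -- Cauchy-Schwarz
  have hcs : (∑ j ∈ Finset.range (r+1), (j.choose (j/2) : ℝ) * (q1^j * u^(r-j) * r.choose j))^2 ≤
      (∑ j ∈ Finset.range (r+1), ((2*q1:ℝ)^j * u^(r-j) * r.choose j)) *
      (∑ j ∈ Finset.range (r+1), ((2*q1:ℝ)^j * u^(r-j) * r.choose j) / (j+1)) := by
    refine Finset.sum_sq_le_sum_mul_sum_of_sq_le_mul _ (fun i _ => by positivity) (fun i _ => by positivity) ?_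
    intro j _
    have h := choose_half j
    have h' : ((j.choose (j/2) : ℝ))^2 ≤ 4^j / (j+1) := by
      rw [le_div_iff₀ (by positivity)]; exact_mod_cast h
    calc ((j.choose (j/2) : ℝ) * ((q1:ℝ)^j * (u:ℝ)^(r-j) * (r.choose j : ℝ)))^2 =
        ((j.choose (j/2) : ℝ))^2 * ((q1:ℝ)^j * (u:ℝ)^(r-j) * (r.choose j : ℝ))^2 := by rw [mul_pow]
      _ ≤ (4:ℝ)^j / (j+1) * ((q1:ℝ)^j * (u:ℝ)^(r-j) * (r.choose j : ℝ))^2 := by gcongr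
      _ = _ := by
        rw [show (4:ℝ) = 2^2 by norm_num, mul_pow 2 (q1:ℝ) j, ← pow_mul, mul_comm 2 j, pow_mul]; ring
  have hs1 : (∑ j ∈ Finset.range (r+1), ((2*q1:ℝ)^j * u^(r-j) * r.choose j)) = (g:ℝ)^r := by
    rw [← add_pow, hgu]; push_cast; rfl
  have hq1r : (1:ℝ) ≤ 2 * q1 := by
    have : (1:ℝ) ≤ q1 := by exact_mod_cast Nat.one_le_iff_ne_zero.2 hq
    linarith
  have hs2 : (∑ j ∈ Finset.range (r+1), ((2*q1:ℝ)^j * u^(r-j) * r.choose j) / (j+1)) * (r+1) ≤ (g:ℝ)^(r+1) := by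
    have : (g:ℝ)^(r+1) = ∑ j ∈ Finset.range (r+1+1), ((2*q1:ℝ)^j * u^(r+1-j) * (r+1).choose j) := by
      rw [← add_pow, hgu]; push_cast; rfl
    rw [this, Finset.sum_range_succ' _ (r+1), Finset.sum_mul]
    refine le_trans (Finset.sum_le_sum fun j hj => ?_) (le_add_of_nonneg_right (by positivity))
    have hch : ((r+1:ℝ)) * r.choose j = (r+1).choose (j+1) * (j+1) := by
      exact_mod_cast Nat.add_one_mul_choose_eq r j
    calc ((2*q1:ℝ)^j * u^(r-j) * r.choose j) / (j+1) * (r+1) =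
        (2*q1:ℝ)^j * u^(r-j) * (((r+1:ℝ)) * r.choose j / (j+1)) := by ring
      _ = (2*q1:ℝ)^j * u^(r-j) * (r+1).choose (j+1) := by
        rw [hch]; field_simp
      _ ≤ (2*q1:ℝ)^(j+1) * u^(r+1-(j+1)) * (r+1).choose (j+1) := by
        rw [Nat.add_sub_add_right]
        gcongr
        omega
  calc _ ≤ (∑ j ∈ Finset.range (r+1), (j.choose (j/2) : ℝ) * (q1^j * u^(r-j) * r.choose j))^2 * (r+1) := by
        gcongr
    _ ≤ _ := by
        refine (mul_le_mul_of_nonneg_right hcs (by positivity)).trans ?_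
        rw [hs1, mul_assoc, show 2*r+1 = r + (r+1) by ring, pow_add (g:ℝ) r (r+1)]
        gcongr

lemma exists_root (g r : ℕ) (P : Finset ℕ) (hP : ∀ p ∈ P, p.Prime) (hPg : ∀ p ∈ P, ¬ p ∣ g) (L : ℕ) :
    ∃ a : ℕ → ℕ, ∀ p ∈ P, ∀ n, n ≡ a p [MOD p] → p ∣ n * g^r + L := by
  have : ∀ p, ∃ a : ℕ, p ∈ P → ∀ n, n ≡ a [MOD p] → p ∣ n * g^r + L := by
    intro p
    by_cases hp : p ∈ P
    · have hpp := hP p hp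
      haveI : Fact p.Prime := ⟨hpp⟩
      refine ⟨((-(L:ZMod p)) * ((g:ZMod p)^r)⁻¹).val, fun _ n hn => ?_⟩
      have hg0 : (g:ZMod p) ≠ 0 := fun h => hPg p hp ((ZMod.natCast_eq_zero_iff _ _).1 h)
      have hn' := (ZMod.natCast_eq_natCast_iff _ _ _).2 hn
      rw [ZMod.natCast_zmod_val] at hn'
      rw [← ZMod.natCast_eq_zero_iff]
      push_cast
      rw [hn']
      field_simp
      ring
    · exact ⟨0, fun h => absurd h hp⟩
  choose a ha using this
  exact ⟨a, ha⟩

lemma card_primeFactors_le (m n : ℕ) (h : m < 2^n) (hm : m ≠ 0) : m.primeFactors.card ≤ n := by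
  have h1 : 2^m.primeFactors.card ≤ m := by
    calc 2^m.primeFactors.card = ∏ p ∈ m.primeFactors, 2 := by simp
      _ ≤ ∏ p ∈ m.primeFactors, p :=
        Finset.prod_le_prod' fun p hp => (Nat.prime_of_mem_primeFactors hp).two_le
      _ ≤ m := Nat.le_of_dvd (Nat.pos_of_ne_zero hm) (Nat.prod_primeFactors_dvd m)
  have := lt_of_le_of_lt h1 h
  exact ((Nat.pow_lt_pow_iff_right (by norm_num)).1 this).le

lemma one_sub_inv_pos (p : ℕ) (hp : 2 ≤ p) : (0:ℝ) < 1 - 1 / p := by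
  have h2 : (2:ℝ) ≤ p := by exact_mod_cast hp
  rw [sub_pos, div_lt_one (by linarith)]; linarith

lemma sieve_prod (z m K : ℕ) (hz : 2 ≤ z) (hK : 1 ≤ K) (hm0 : m ≠ 0) (hm : m.primeFactors.card ≤ 2^K) :
    ∏ p ∈ z.primesBelow.filter (fun p => ¬ p ∣ m), (1 - 2 / p : ℝ) ≤
      (Real.exp 12 * (K:ℝ)^8 / Real.log z)^2 := by
  have hlog : 0 < Real.log z := Real.log_pos (by exact_mod_cast hz)
  have hpr : ∀ p ∈ z.primesBelow, 2 ≤ p := fun p hp => (Nat.prime_of_mem_primesBelow hp).two_le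
  have h1 : ∏ p ∈ z.primesBelow.filter (fun p => ¬ p ∣ m), (1 - 2 / p : ℝ) ≤
      (∏ p ∈ z.primesBelow.filter (fun p => ¬ p ∣ m), (1 - 1 / p : ℝ))^2 := by
    rw [← Finset.prod_pow]
    refine Finset.prod_le_prod (fun p hp => ?_) (fun p hp => ?_)
    · have h2 : (2:ℝ) ≤ p := by exact_mod_cast hpr p (Finset.mem_filter.1 hp).1
      rw [sub_nonneg, div_le_one (by linarith)]; exact h2
    · have : (1 - 1 / p : ℝ)^2 = 1 - 2 / p + (1/p)^2 := by ring
      rw [this]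
      have : (0:ℝ) ≤ (1/p)^2 := by positivity
      linarith
  refine h1.trans ?_
  have hpos : ∀ s ⊆ z.primesBelow, (0:ℝ) < ∏ p ∈ s, (1 - 1 / p : ℝ) := fun s hs =>
    Finset.prod_pos fun p hp => one_sub_inv_pos p (hpr p (hs hp))
  have h2 := Finset.prod_filter_mul_prod_filter_not z.primesBelow (fun p => p ∣ m) (fun p => (1 - 1 / p : ℝ))
  have h3 := mertens_prod z (by omega)
  rw [Finset.prod_inv_distrib] at h3
  have h4 := totient_loss m K hK hm
  have h5 : ∏ p ∈ m.primeFactors, (1 - 1 / p : ℝ) ≤ ∏ p ∈ z.primesBelow.filter (fun p => p ∣ m), (1 - 1 / p : ℝ) := by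
    have hsub : z.primesBelow.filter (fun p => p ∣ m) ⊆ m.primeFactors := by
      intro p hp
      rw [Finset.mem_filter] at hp
      exact Nat.mem_primeFactors.2 ⟨Nat.prime_of_mem_primesBelow hp.1, hp.2, hm0⟩
    rw [← Finset.prod_sdiff hsub]
    refine mul_le_of_le_one_left (hpos _ (Finset.filter_subset _ _)).le ?_
    refine Finset.prod_le_one (fun p hp => ?_) (fun p hp => ?_)
    · exact (one_sub_inv_pos p (Nat.prime_of_mem_primeFactors (Finset.mem_sdiff.1 hp).1).two_le).le
    · have : (0:ℝ) ≤ 1 / p := by positivity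
      linarith
  rw [Finset.prod_inv_distrib] at h4
  have hmpos : (0:ℝ) < ∏ p ∈ m.primeFactors, (1 - 1 / p : ℝ) :=
    Finset.prod_pos fun p hp => one_sub_inv_pos p (Nat.prime_of_mem_primeFactors hp).two_le
  have hA := hpos (z.primesBelow.filter (fun p => p ∣ m)) (Finset.filter_subset _ _)
  have hB := hpos (z.primesBelow.filter (fun p => ¬ p ∣ m)) (Finset.filter_subset _ _)
  have hC := hpos _ (Finset.Subset.refl z.primesBelow)
  set A := ∏ p ∈ z.primesBelow.filter (fun p => p ∣ m), (1 - 1 / p : ℝ)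
  set B := ∏ p ∈ z.primesBelow.filter (fun p => ¬ p ∣ m), (1 - 1 / p : ℝ)
  set Cc := ∏ p ∈ z.primesBelow, (1 - 1 / p : ℝ)
  set M := ∏ p ∈ m.primeFactors, (1 - 1 / p : ℝ)
  gcongr
  rw [le_div_iff₀ hlog]
  refine le_trans ?_ h4
  calc B * Real.log z ≤ B * Cc⁻¹ := by gcongr
    _ = A⁻¹ := by rw [← h2]; field_simp
    _ ≤ M⁻¹ := by gcongr

lemma pair_bound (g r J K t L1 L2 : ℕ) (hg : 2 ≤ g) (h1 : L1 < g^r) (h2 : L2 < g^r) (h12 : L1 ≠ L2)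
    (hJ : 1 ≤ J) (hJr : 2^J ≤ g^r) (hK : 1 ≤ K) (hKr : g * (r+1) ≤ 2^K) (ht : Even t) :
    (((Finset.range (g^r)).filter (fun H => (H * g^r + L1).Prime ∧ (H * g^r + L2).Prime)).card : ℝ) ≤
     1 + ((g:ℝ)^r * ((Real.exp 12 * (K:ℝ)^8 / Real.log ((2^J : ℕ):ℝ))^2 +
       (2 * (5 + 4 * Real.log J))^(t+1) / (t+1).factorial) + (2 * 2^J + 1)^t) := by
  set m := g * ((L1 - L2) + (L2 - L1)) with hm
  have hm0 : m ≠ 0 := Nat.mul_ne_zero (by omega) (by omega)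
  have hmK : m.primeFactors.card ≤ 2^K := by
    refine (card_primeFactors_le m (g*(r+1)) ?_ hm0).trans hKr
    calc m < g * g^r := Nat.mul_lt_mul_of_pos_left (by omega) (by omega)
      _ = g^(r+1) := by ring
      _ ≤ (2^g)^(r+1) := Nat.pow_le_pow_left Nat.lt_two_pow_self.le _
      _ = 2^(g*(r+1)) := by rw [pow_mul]
  set z := 2^J with hz
  have hz2 : 2 ≤ z := by
    calc 2 = 2^1 := by norm_num
      _ ≤ 2^J := Nat.pow_le_pow_right (by norm_num) hJ
  set P := z.primesBelow.filter (fun p => ¬ p ∣ m) with hPdef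
  have hP : ∀ p ∈ P, p.Prime := fun p hp => Nat.prime_of_mem_primesBelow (Finset.mem_filter.1 hp).1
  have hPz : ∀ p ∈ P, p < z := fun p hp => Nat.lt_of_mem_primesBelow (Finset.mem_filter.1 hp).1
  have hPm : ∀ p ∈ P, ¬ p ∣ m := fun p hp => (Finset.mem_filter.1 hp).2
  have hPg : ∀ p ∈ P, ¬ p ∣ g := fun p hp h => hPm p hp (h.mul_right _)
  obtain ⟨a, ha⟩ := exists_root g r P hP hPg L1
  obtain ⟨b, hb⟩ := exists_root g r P hP hPg L2
  have hab : ∀ p ∈ P, ¬ a p ≡ b p [MOD p] := by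
    intro p hp h
    have e1 := ha p hp (a p) (Nat.ModEq.refl _)
    have e2 := hb p hp (a p) h
    apply hPm p hp
    rcases lt_or_gt_of_ne h12 with hl | hl
    · have := Nat.dvd_sub e2 e1
      rw [Nat.add_sub_add_left] at this
      rw [hm, Nat.sub_eq_zero_of_le hl.le, zero_add]
      exact this.mul_left _
    · have := Nat.dvd_sub e1 e2
      rw [Nat.add_sub_add_left] at this
      rw [hm, Nat.sub_eq_zero_of_le hl.le, add_zero]
      exact this.mul_left _
  have hs := sieve_bound (g^r) a b P hP hab t ht
  have hsub : (Finset.range (g^r)).filter (fun H => (H * g^r + L1).Prime ∧ (H * g^r + L2).Prime) ⊆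
      insert 0 ((Finset.range (g^r)).filter (fun n =>
        ∀ p ∈ P, ¬ (n ≡ a p [MOD p] ∨ n ≡ b p [MOD p]))) := by
    intro H hH
    rw [Finset.mem_filter] at hH
    obtain ⟨hr, hp1, hp2⟩ := hH
    rw [Finset.mem_insert]
    by_cases h0 : H = 0
    · exact Or.inl h0
    right
    refine Finset.mem_filter.2 ⟨hr, fun p hp hor => ?_⟩
    have hge : z ≤ H * g^r := hJr.trans (Nat.le_mul_of_pos_left _ (Nat.pos_of_ne_zero h0))
    have hpz := hPz p hp
    rcases hor with h | h
    · have := (Nat.prime_dvd_prime_iff_eq (hP p hp) hp1).1 (ha p hp H h)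
      omega
    · have := (Nat.prime_dvd_prime_iff_eq (hP p hp) hp2).1 (hb p hp H h)
      omega
  have hc : (((Finset.range (g^r)).filter (fun H => (H * g^r + L1).Prime ∧ (H * g^r + L2).Prime)).card : ℝ)
      ≤ 1 + (((Finset.range (g^r)).filter (fun n =>
        ∀ p ∈ P, ¬ (n ≡ a p [MOD p] ∨ n ≡ b p [MOD p]))).card : ℝ) := by
    have := (Finset.card_le_card hsub).trans (Finset.card_insert_le _ _)
    rw [add_comm]
    exact_mod_cast this
  refine hc.trans (add_le_add le_rfl (hs.trans ?_))
  have hprod := sieve_prod z m K hz2 hK hm0 hmK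
  have hsum : ∑ p ∈ P, (2 / p : ℝ) ≤ 2 * (5 + 4 * Real.log J) := by
    refine le_trans ?_ (mul_le_mul_of_nonneg_left (sum_inv_primes_le J hJ) (by norm_num))
    rw [Finset.mul_sum]
    simp only [mul_one_div]
    refine Finset.sum_le_sum_of_subset_of_nonneg ?_ (fun _ _ _ => by positivity)
    intro p hp
    have := hPz p hp
    simp only [Finset.mem_filter, Finset.mem_range]
    exact ⟨by omega, hP p hp⟩
  have hcard : (P.card : ℝ) ≤ 2^J := by
    have : P.card ≤ z := by
      refine (Finset.card_filter_le _ _).trans ((Finset.card_filter_le _ _).trans ?_)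
      simp
    exact_mod_cast this
  push_cast
  gcongr


lemma bad_windows (g k r : ℕ) (hg : 2 ≤ g)
    (hno : ¬ ∃ q : Fin k → ℕ, (∀ i, Nat.Prime (q i)) ∧ StrictMono q ∧
      (∀ i, max g k < q i) ∧ StrictAnti (fun i => dsum g (q i)))
    (PP : Finset ℕ) (hPP : PP = (Finset.range (g^(2*r))).filter (fun q => q.Prime ∧ max g k < q)) :
    ((Finset.range (g^r)).filter (fun H =>
      k ≤ ((PP.filter (fun q => q / g^r = H)).image (dsum g)).card)).card ≤ k * (2*r*g+1)^k := by
  classical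
  by_contra hcon
  push Not at hcon
  set Bad := (Finset.range (g^r)).filter (fun H =>
      k ≤ ((PP.filter (fun q => q / g^r = H)).image (dsum g)).card) with hBad
  have hex : ∀ H, ∃ U : Finset ℕ, H ∈ Bad → U ⊆ (PP.filter (fun q => q / g^r = H)).image (dsum g) ∧ U.card = k := by
    intro H
    by_cases h : H ∈ Bad
    · obtain ⟨U, h1, h2⟩ := Finset.exists_subset_card_eq (Finset.mem_filter.1 h).2
      exact ⟨U, fun _ => ⟨h1, h2⟩⟩
    · exact ⟨∅, fun h' => absurd h' h⟩
  choose U hU using hex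
  have hmaps : ∀ H ∈ Bad, U H ∈ (Finset.range (2*r*g+1)).powersetCard k := by
    intro H hH
    refine Finset.mem_powersetCard.2 ⟨fun v hv => ?_, (hU H hH).2⟩
    obtain ⟨q, hq, rfl⟩ := Finset.mem_image.1 ((hU H hH).1 hv)
    have hq' := (Finset.mem_filter.1 hq).1
    rw [hPP, Finset.mem_filter, Finset.mem_range] at hq'
    have := dsum_le g hg (2*r) q hq'.1
    rw [Finset.mem_range]; omega
  have hcardlt : ((Finset.range (2*r*g+1)).powersetCard k).card * k < Bad.card := by
    refine lt_of_le_of_lt ?_ hcon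
    rw [Finset.card_powersetCard, Finset.card_range, mul_comm]
    exact Nat.mul_le_mul_left _ (Nat.choose_le_pow _ _)
  obtain ⟨V, hV, hVk⟩ := Finset.exists_lt_card_fiber_of_mul_lt_card_of_maps_to hmaps hcardlt
  have hVcard : V.card = k := (Finset.mem_powersetCard.1 hV).2
  obtain ⟨T, hT, hTk⟩ := Finset.exists_subset_card_eq hVk.le
  have hq : ∀ i : Fin k, ∃ q ∈ PP, q / g^r = T.orderEmbOfFin hTk i ∧
      dsum g q = V.orderEmbOfFin hVcard (Fin.rev i) := by
    intro i
    have hi := hT (T.orderEmbOfFin_mem hTk i)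
    rw [Finset.mem_filter] at hi
    have hv := V.orderEmbOfFin_mem hVcard (Fin.rev i)
    have hv2 : V.orderEmbOfFin hVcard (Fin.rev i) ∈ U (T.orderEmbOfFin hTk i) := by
      rw [hi.2]; exact hv
    obtain ⟨q, hq, h⟩ := Finset.mem_image.1 ((hU _ hi.1).1 hv2)
    rw [Finset.mem_filter] at hq
    exact ⟨q, hq.1, hq.2, h⟩
  choose q hq1 hq2 hq3 using hq
  have hq1' : ∀ i, (q i).Prime ∧ max g k < q i := by
    intro i
    have := hq1 i
    rw [hPP, Finset.mem_filter] at this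
    exact this.2
  refine hno ⟨q, fun i => (hq1' i).1, ?_, fun i => (hq1' i).2, ?_⟩
  · intro i j hij
    have : q i / g^r < q j / g^r := by
      rw [hq2, hq2]; exact (T.orderEmbOfFin hTk).strictMono hij
    by_contra hle
    push Not at hle
    exact absurd (Nat.div_le_div_right (c := g^r) hle) (by omega)
  · intro i j hij
    simp only [hq3]
    exact (V.orderEmbOfFin hVcard).strictMono (Fin.rev_lt_rev.2 hij)

lemma window_cs (X : Finset ℕ) (s : ℕ → ℕ) (k : ℕ) (hk : (X.image s).card ≤ k) :
    X.card^2 ≤ k * ((X ×ˢ X).filter (fun x => s x.1 = s x.2)).card := by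
  classical
  have h1 : X.card = ∑ v ∈ X.image s, (X.filter (fun q => s q = v)).card :=
    Finset.card_eq_sum_card_image s X
  have h2 : ((X ×ˢ X).filter (fun x => s x.1 = s x.2)).card =
      ∑ v ∈ X.image s, (X.filter (fun q => s q = v)).card^2 := by
    rw [Finset.card_eq_sum_card_fiberwise (f := fun x => s x.1) (t := X.image s)]
    · refine Finset.sum_congr rfl fun v _ => ?_
      rw [sq, ← Finset.card_product]
      congr 1
      ext ⟨x, y⟩
      simp only [Finset.mem_filter, Finset.mem_product]
      constructor
      · rintro ⟨⟨⟨h1, h2⟩, h3⟩, h4⟩; exact ⟨⟨h1, h4⟩, h2, h3 ▸ h4⟩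
      · rintro ⟨⟨h1, h2⟩, h3, h4⟩; exact ⟨⟨⟨h1, h3⟩, h2.trans h4.symm⟩, h2⟩
    · intro x hx
      simp only [Finset.coe_filter, Set.mem_setOf_eq, Finset.mem_product] at hx
      exact Finset.mem_coe.2 (Finset.mem_image_of_mem s hx.1.1)
  rw [h2]
  calc X.card^2 = (∑ v ∈ X.image s, (X.filter (fun q => s q = v)).card)^2 := by rw [← h1]
    _ ≤ (X.image s).card * ∑ v ∈ X.image s, (X.filter (fun q => s q = v)).card^2 :=
      sq_sum_le_card_mul_sum_sq
    _ ≤ _ := Nat.mul_le_mul_right _ hk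

lemma windows (g k r : ℕ) (hg : 2 ≤ g)
    (hno : ¬ ∃ q : Fin k → ℕ, (∀ i, Nat.Prime (q i)) ∧ StrictMono q ∧
      (∀ i, max g k < q i) ∧ StrictAnti (fun i => dsum g (q i)))
    (PP : Finset ℕ) (hPP : PP = (Finset.range (g^(2*r))).filter (fun q => q.Prime ∧ max g k < q)) :
    ∃ G : ℕ, PP.card ≤ k * (2*r*g+1)^k * g^r + G ∧
      G^2 ≤ g^r * (k * ((PP ×ˢ PP).filter (fun x => x.1 / g^r = x.2 / g^r ∧ dsum g x.1 = dsum g x.2)).card) := by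
  classical
  have hbad := bad_windows g k r hg hno PP hPP
  set W : ℕ → Finset ℕ := fun H => PP.filter (fun q => q / g^r = H) with hW
  have hgr : 0 < g^r := by positivity
  have hmaps : ∀ q ∈ PP, q / g^r ∈ Finset.range (g^r) := by
    intro q hq
    rw [hPP, Finset.mem_filter, Finset.mem_range] at hq
    rw [Finset.mem_range, Nat.div_lt_iff_lt_mul hgr, ← pow_add, ← two_mul]
    exact hq.1
  have hcard : PP.card = ∑ H ∈ Finset.range (g^r), (W H).card :=
    Finset.card_eq_sum_card_fiberwise hmaps
  set bad : ℕ → Prop := fun H => k ≤ ((W H).image (dsum g)).card with hbaddef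
  refine ⟨∑ H ∈ (Finset.range (g^r)).filter (fun H => ¬ bad H), (W H).card, ?_, ?_⟩
  · rw [hcard, ← Finset.sum_filter_add_sum_filter_not _ bad]
    refine Nat.add_le_add_right ?_ _
    have hWle : ∀ H, (W H).card ≤ g^r := by
      intro H
      have : W H ⊆ Finset.Ico (H * g^r) (H * g^r + g^r) := by
        intro q hq
        have := (Finset.mem_filter.1 hq).2
        rw [Finset.mem_Ico]
        have e := Nat.div_add_mod q (g^r)
        have e2 := Nat.mod_lt q hgr
        rw [this, mul_comm] at e
        constructor <;> linarith [Nat.zero_le (q % g^r)]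
      exact (Finset.card_le_card this).trans (by simp)
    calc _ ≤ ∑ H ∈ (Finset.range (g^r)).filter bad, g^r := Finset.sum_le_sum fun H _ => hWle H
      _ = ((Finset.range (g^r)).filter bad).card * g^r := by rw [Finset.sum_const, smul_eq_mul]
      _ ≤ _ := Nat.mul_le_mul_right _ hbad
  · calc _ ≤ ((Finset.range (g^r)).filter (fun H => ¬ bad H)).card *
          ∑ H ∈ (Finset.range (g^r)).filter (fun H => ¬ bad H), (W H).card^2 := sq_sum_le_card_mul_sum_sq
      _ ≤ g^r * ∑ H ∈ (Finset.range (g^r)).filter (fun H => ¬ bad H),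
          k * ((W H ×ˢ W H).filter (fun x => dsum g x.1 = dsum g x.2)).card := by
          refine Nat.mul_le_mul ((Finset.card_filter_le _ _).trans (by simp)) (Finset.sum_le_sum fun H hH => ?_)
          refine window_cs _ _ _ ?_
          exact (not_le.1 (Finset.mem_filter.1 hH).2).le
      _ ≤ g^r * ∑ H ∈ (Finset.range (g^r)),
          k * ((W H ×ˢ W H).filter (fun x => dsum g x.1 = dsum g x.2)).card :=
          Nat.mul_le_mul_left _ (Finset.sum_le_sum_of_subset (Finset.filter_subset _ _))
      _ = _ := by
          rw [← Finset.mul_sum]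
          congr 2
          symm
          rw [Finset.card_eq_sum_card_fiberwise (f := fun x => x.1 / g^r) (t := Finset.range (g^r))]
          · refine Finset.sum_congr rfl fun H _ => ?_
            congr 1
            ext ⟨x, y⟩
            simp only [Finset.mem_filter, Finset.mem_product, hW]
            constructor
            · rintro ⟨⟨⟨h1, h2⟩, h3, h4⟩, h5⟩; exact ⟨⟨⟨h1, h5⟩, h2, h3 ▸ h5⟩, h4⟩
            · rintro ⟨⟨⟨h1, h2⟩, h3, h4⟩, h5⟩; exact ⟨⟨⟨h1, h3⟩, h2.trans h4.symm, h5⟩, h2⟩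
          · intro x hx
            simp only [Finset.coe_filter, Set.mem_setOf_eq, Finset.mem_product] at hx
            exact Finset.mem_coe.2 (hmaps _ hx.1.1)

lemma pairs_count (g r : ℕ) (hg : 2 ≤ g) (PP : Finset ℕ) (hPP : ∀ q ∈ PP, q.Prime ∧ q < g^(2*r))
    (D A : ℝ) (hA : ∀ w, (((Finset.range (g^r)).filter (fun L => dsum g L = w)).card : ℝ) ≤ A)
    (hD0 : 0 ≤ D)
    (hD : ∀ L1 < g^r, ∀ L2 < g^r, L1 ≠ L2 → (((Finset.range (g^r)).filter (fun H => (H * g^r + L1).Prime ∧ (H * g^r + L2).Prime)).card : ℝ) ≤ D) :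
    (((PP ×ˢ PP).filter (fun x => x.1 / g^r = x.2 / g^r ∧ dsum g x.1 = dsum g x.2)).card : ℝ) ≤
      (g:ℝ)^(2*r) + (g:ℝ)^r * A * D := by
  classical
  have hgr : 0 < g^r := by positivity
  set E := (PP ×ˢ PP).filter (fun x => x.1 / g^r = x.2 / g^r ∧ dsum g x.1 = dsum g x.2) with hE
  set R := Finset.range (g^r)
  set LL := (R ×ˢ R).filter (fun y => dsum g y.1 = dsum g y.2) with hLL
  have hmaps : ∀ x ∈ E, (x.1 % g^r, x.2 % g^r) ∈ LL := by
    rintro ⟨x, y⟩ h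
    simp only [hE, Finset.mem_filter, Finset.mem_product] at h
    simp only [hLL, Finset.mem_filter, Finset.mem_product, R, Finset.mem_range]
    have m1 := Nat.mod_lt x hgr
    have m2 := Nat.mod_lt y hgr
    refine ⟨⟨m1, m2⟩, ?_⟩
    have e1 := dsum_split g hg r (x / g^r) (x % g^r) m1
    have e2 := dsum_split g hg r (y / g^r) (y % g^r) m2
    rw [Nat.div_add_mod'] at e1 e2
    have := h.2.2
    rw [e1, e2, h.2.1] at this
    omega
  have hcard : E.card = ∑ y ∈ LL, (E.filter (fun x => (x.1 % g^r, x.2 % g^r) = y)).card :=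
    Finset.card_eq_sum_card_fiberwise hmaps
  have hfib : ∀ y : ℕ × ℕ, (E.filter (fun x => (x.1 % g^r, x.2 % g^r) = y)).card ≤
      (R.filter (fun H => (H * g^r + y.1).Prime ∧ (H * g^r + y.2).Prime)).card := by
    intro y
    refine Finset.card_le_card_of_injOn (fun x => x.1 / g^r) ?_ ?_
    · rintro ⟨a, b⟩ h
      simp only [hE, Finset.coe_filter, Set.mem_setOf_eq, Finset.mem_filter, Finset.mem_product] at h
      obtain ⟨⟨⟨ha, hb⟩, h1, h2⟩, rfl⟩ := h
      simp only [Finset.coe_filter, Set.mem_setOf_eq, R, Finset.mem_range]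
      refine ⟨?_, ?_, ?_⟩
      · rw [Nat.div_lt_iff_lt_mul hgr, ← pow_add, ← two_mul]; exact (hPP a ha).2
      · rw [Nat.div_add_mod']; exact (hPP a ha).1
      · rw [h1, Nat.div_add_mod']; exact (hPP b hb).1
    · rintro ⟨a, b⟩ h ⟨c, d⟩ h' heq
      simp only [hE, Finset.coe_filter, Set.mem_setOf_eq, Finset.mem_filter, Finset.mem_product] at h h' heq
      obtain ⟨⟨⟨ha, hb⟩, h1, h2⟩, h3⟩ := h
      obtain ⟨⟨⟨hc, hd⟩, h1', h2'⟩, h3'⟩ := h'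
      rw [← h3', Prod.mk.injEq] at h3
      have e1 := Nat.div_add_mod' a (g^r)
      have e2 := Nat.div_add_mod' b (g^r)
      rw [heq, h3.1, Nat.div_add_mod'] at e1
      rw [← h1, heq, h1', h3.2, Nat.div_add_mod'] at e2
      rw [e1, e2]
  have hLLcard : (LL.card : ℝ) ≤ (g:ℝ)^r * A := by
    have : LL.card = ∑ a ∈ R, (R.filter (fun b => dsum g b = dsum g a)).card := by
      rw [hLL, Finset.card_filter, Finset.sum_product]
      refine Finset.sum_congr rfl fun a _ => ?_
      rw [Finset.card_filter]
      refine Finset.sum_congr rfl fun b _ => ?_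
      simp [eq_comm]
    rw [this]
    push_cast
    refine (Finset.sum_le_sum fun a _ => hA (dsum g a)).trans ?_
    rw [Finset.sum_const, Finset.card_range, nsmul_eq_mul]
    push_cast; exact le_rfl
  have hterm : ∀ y ∈ LL, (((E.filter (fun x => (x.1 % g^r, x.2 % g^r) = y)).card : ℕ) : ℝ) ≤
      (if y.1 = y.2 then (g:ℝ)^r else 0) + D := by
    intro y hy
    simp only [hLL, Finset.mem_filter, Finset.mem_product, R, Finset.mem_range] at hy
    have h1 : (((E.filter (fun x => (x.1 % g^r, x.2 % g^r) = y)).card : ℕ) : ℝ) ≤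
      ((R.filter (fun H => (H * g^r + y.1).Prime ∧ (H * g^r + y.2).Prime)).card : ℝ) := by
      exact_mod_cast hfib y
    split_ifs with h
    · have : ((R.filter (fun H => (H * g^r + y.1).Prime ∧ (H * g^r + y.2).Prime)).card : ℝ) ≤ (g:ℝ)^r := by
        have := Finset.card_filter_le R (fun H => (H * g^r + y.1).Prime ∧ (H * g^r + y.2).Prime)
        rw [Finset.card_range] at this
        exact_mod_cast this
      linarith
    · have := hD y.1 hy.1.1 y.2 hy.1.2 h
      linarith
  rw [hcard]
  push_cast
  refine (Finset.sum_le_sum hterm).trans ?_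
  rw [Finset.sum_add_distrib, Finset.sum_const, nsmul_eq_mul]
  refine add_le_add ?_ (mul_le_mul_of_nonneg_right hLLcard hD0)
  rw [← Finset.sum_filter, Finset.sum_const, nsmul_eq_mul, two_mul, pow_add]
  gcongr
  have : (LL.filter (fun y => y.1 = y.2)).card ≤ R.card := by
    refine Finset.card_le_card_of_injOn Prod.fst ?_ ?_
    · intro y hy
      simp only [hLL, Finset.coe_filter, Set.mem_setOf_eq, Finset.mem_filter, Finset.mem_product] at hy
      exact hy.1.1.1
    · rintro ⟨a, b⟩ h ⟨c, d⟩ h' heq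
      simp only [Finset.coe_filter, Set.mem_setOf_eq] at h h' heq
      rw [← h.2, ← h'.2, heq]
  rw [Finset.card_range] at this
  exact_mod_cast this

theorem growth_ev (C : ℝ) (m : ℕ) : ∃ K0 : ℕ, ∀ K : ℕ, K0 ≤ K → C * (K:ℝ)^m ≤ 2^K := by
  have h := tendsto_pow_const_div_const_pow_of_one_lt m (r := (2:ℝ)) (by norm_num)
  have h2 := h.const_mul C
  rw [mul_zero] at h2
  have h3 := h2.eventually (gt_mem_nhds (show (0:ℝ) < 1 by norm_num))
  obtain ⟨K0, h4⟩ := Filter.eventually_atTop.1 h3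
  refine ⟨K0, fun K hK => ?_⟩
  have h5 := h4 K hK
  rw [← mul_div_assoc, div_lt_one (by positivity)] at h5
  exact h5.le

theorem D_bound (g K : ℕ) (hg : 2 ≤ g) (hK : 2 ≤ K)
    (h1 : Real.exp 20 * (K:ℝ)^2754 ≤ 2^K) :
    (1:ℝ) + ((g:ℝ)^(4*K^170) * ((Real.exp 12 * (K:ℝ)^8 / Real.log ((2^(K^153) : ℕ):ℝ))^2
      + (2*(5+4*Real.log (K^153 : ℕ)))^(2*K^17+1) / (2*K^17+1).factorial)
      + (2*2^(K^153)+1)^(2*K^17)) ≤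
    (g:ℝ)^(4*K^170) * ((Real.exp 12 / Real.log 2)^2 + 3) * (K:ℝ)^16 / ((K:ℝ)^153)^2 := by
  set Y : ℝ := (g:ℝ)^(4*K^170) with hY
  have hK1 : (1:ℝ) ≤ K := by exact_mod_cast (by omega : 1 ≤ K)
  have hKpos : (0:ℝ) < K := by linarith
  have hg2 : (2:ℝ) ≤ g := by exact_mod_cast hg
  have hYpos : 0 < Y := by positivity
  have hJ : (0:ℝ) < ((K:ℝ)^153)^2 := by positivity
  have h2Y : (2:ℝ)^(4*K^170) ≤ Y := pow_le_pow_left₀ (by norm_num) hg2 _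
  have hKv : K ≤ K^17 := Nat.le_self_pow (by norm_num) K
  have hKv' : K^17 ≤ K^170 := Nat.pow_le_pow_right (by omega) (by norm_num)
  have he : (1:ℝ) ≤ Real.exp 20 := Real.one_le_exp (by norm_num)
  have hJ2 : ((K:ℝ)^153)^2 ≤ 2^K := by
    calc ((K:ℝ)^153)^2 = (K:ℝ)^306 := by ring
      _ ≤ (K:ℝ)^2754 := pow_le_pow_right₀ hK1 (by norm_num)
      _ ≤ Real.exp 20 * (K:ℝ)^2754 := le_mul_of_one_le_left (by positivity) he
      _ ≤ _ := h1
  have hK16 : (1:ℝ) ≤ (K:ℝ)^16 := one_le_pow₀ hK1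
  -- term one
  have t1 : (1:ℝ) ≤ Y / ((K:ℝ)^153)^2 := by
    rw [le_div_iff₀ hJ, one_mul]
    refine hJ2.trans (le_trans ?_ h2Y)
    exact pow_le_pow_right₀ (by norm_num) (by omega)
  have t2 : (Real.exp 12 * (K:ℝ)^8 / Real.log ((2^(K^153) : ℕ):ℝ))^2
      = (Real.exp 12 / Real.log 2)^2 * (K:ℝ)^16 / ((K:ℝ)^153)^2 := by
    push_cast
    rw [Real.log_pow]
    have : Real.log 2 ≠ 0 := (Real.log_pos (by norm_num)).ne'
    push_cast
    field_simp
  have t3 : (2*(5+4*Real.log (K^153 : ℕ)))^(2*K^17+1) / ((2*K^17+1).factorial : ℝ)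
      ≤ 1 / ((K:ℝ)^153)^2 := by
    set S : ℝ := 2*(5+4*Real.log (K^153 : ℕ)) with hS
    have hl : 0 ≤ Real.log (K^153 : ℕ) := Real.log_natCast_nonneg _
    have hS0 : 0 ≤ S := by positivity
    have a := Real.pow_div_factorial_le_exp (2*S) (by positivity) (2*K^17+1)
    have b : Real.exp (2*S) = Real.exp 20 * (K:ℝ)^2448 := by
      have : 2*S = 20 + (16:ℕ) * Real.log (K^153 : ℕ) := by rw [hS]; push_cast; ring
      rw [this, Real.exp_add, Real.exp_nat_mul, Real.exp_log (by positivity)]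
      push_cast; ring
    rw [b, mul_pow, mul_div_assoc] at a
    rw [le_div_iff₀ hJ]
    have c : (2:ℝ)^K ≤ 2^(2*K^17+1) := pow_le_pow_right₀ (by norm_num) (by omega)
    have d : (2:ℝ)^(2*K^17+1) * (S^(2*K^17+1) / ((2*K^17+1).factorial : ℝ) * ((K:ℝ)^153)^2)
       ≤ (2:ℝ)^(2*K^17+1) * 1 := by
      calc _ = (2:ℝ)^(2*K^17+1) * (S^(2*K^17+1) / ((2*K^17+1).factorial : ℝ)) * ((K:ℝ)^153)^2 := by ring
        _ ≤ Real.exp 20 * (K:ℝ)^2448 * ((K:ℝ)^153)^2 := by gcongr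
        _ = Real.exp 20 * (K:ℝ)^2754 := by ring
        _ ≤ _ := by linarith
    exact le_of_mul_le_mul_left d (by positivity)
  have t4 : (2*2^(K^153)+1 : ℝ)^(2*K^17) ≤ Y / ((K:ℝ)^153)^2 := by
    rw [le_div_iff₀ hJ]
    have a : (2*2^(K^153)+1 : ℝ) ≤ 2^(K^153+2) := by
      have : (1:ℝ) ≤ 2^(K^153) := one_le_pow₀ (by norm_num)
      rw [pow_add]; linarith
    calc (2*2^(K^153)+1 : ℝ)^(2*K^17) * ((K:ℝ)^153)^2
        ≤ (2^(K^153+2))^(2*K^17) * 2^K := by gcongr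
      _ = 2^((K^153+2)*(2*K^17) + K) := by rw [← pow_mul, ← pow_add]
      _ ≤ 2^(4*K^170) := by
        apply pow_le_pow_right₀ (by norm_num)
        have e : (K^153+2)*(2*K^17) = 2*K^170 + 4*K^17 := by ring
        have e2 : K^170 = K^17 * K^153 := by ring
        have e3 : 2^153 ≤ K^153 := Nat.pow_le_pow_left hK _
        have e4 : K^17 * 8 ≤ K^17 * K^153 := Nat.mul_le_mul_left _ (le_trans (by norm_num) e3)
        omega
      _ ≤ Y := h2Y
  rw [t2]
  have : Y * ((Real.exp 12 / Real.log 2)^2 + 3) * (K:ℝ)^16 / ((K:ℝ)^153)^2 =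
    Y * ((Real.exp 12 / Real.log 2)^2 * (K:ℝ)^16 / ((K:ℝ)^153)^2) + 3 * (Y / ((K:ℝ)^153)^2) * (K:ℝ)^16 := by ring
  rw [this]
  have t3' := mul_le_mul_of_nonneg_left t3 hYpos.le
  have e5 : Y * (1 / ((K:ℝ)^153)^2) = Y / ((K:ℝ)^153)^2 := by ring
  rw [e5] at t3'
  have t5 : 3 * (Y / ((K:ℝ)^153)^2) ≤ 3 * (Y / ((K:ℝ)^153)^2) * (K:ℝ)^16 :=
    le_mul_of_one_le_right (by positivity) hK16
  rw [mul_add]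
  linarith

theorem pi_lower (n : ℕ) (hn : 100 ≤ n) : (n:ℝ) / (2 * Real.log n) ≤ (Nat.primeCounting n : ℝ) := by
  have h := Chebyshev.pi_ge n
  refine le_trans ?_ h
  have hn' : (100:ℝ) ≤ n := by exact_mod_cast hn
  have hl : 0 < Real.log n := Real.log_pos (by linarith)
  have e : (n:ℝ) / (2 * Real.log n) = (n/2) / Real.log n := by field_simp
  rw [e]
  apply div_le_div_of_nonneg_right _ hl.le
  have h2 := Real.log_two_gt_d9
  have h3 := Real.log_two_lt_d9
  have h4 : Real.log ((n:ℝ)+1) ≤ ((n:ℝ)+1)/16 - 1 + 4 * Real.log 2 := by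
    have a : Real.log ((n:ℝ)+1) = Real.log (((n:ℝ)+1)/16) + 4 * Real.log 2 := by
      rw [Real.log_div (by positivity) (by norm_num), show (16:ℝ) = 2^4 by norm_num, Real.log_pow]
      push_cast; ring
    have b := Real.log_le_sub_one_of_pos (x := ((n:ℝ)+1)/16) (by positivity)
    linarith
  nlinarith

theorem PP_lower (g k r : ℕ) (hg : 2 ≤ g) (hr : 4 ≤ r) :
    ((g:ℝ)^(2*r)) / (4*r*g) ≤ (((Finset.range (g^(2*r))).filter (fun q => q.Prime ∧ max g k < q)).card : ℝ)
      + (g + k + 1) := by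
  set n := g^(2*r) with hn
  have hn100 : 100 ≤ n := by
    calc 100 ≤ 2^(2*4) := by norm_num
      _ ≤ 2^(2*r) := Nat.pow_le_pow_right (by norm_num) (by omega)
      _ ≤ n := Nat.pow_le_pow_left hg _
  have h := pi_lower n hn100
  have hnp : ¬ n.Prime := Nat.Prime.not_prime_pow (by omega)
  have hcard : Nat.primeCounting n ≤
      ((Finset.range n).filter (fun q => q.Prime ∧ max g k < q)).card + (g+k+1) := by
    rw [Nat.primeCounting, Nat.primeCounting', Nat.count_eq_card_filter_range]
    have : (Finset.range (n+1)).filter Nat.Prime ⊆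
      ((Finset.range n).filter (fun q => q.Prime ∧ max g k < q)) ∪ Finset.range (g+k+1) := by
      intro q hq
      simp only [Finset.mem_filter, Finset.mem_range, Finset.mem_union] at hq ⊢
      by_cases hc : max g k < q
      · left
        refine ⟨?_, hq.2, hc⟩
        rcases Nat.lt_succ_iff_lt_or_eq.1 hq.1 with h | h
        · exact h
        · exact absurd (h ▸ hq.2) hnp
      · right
        omega
    refine (Finset.card_le_card this).trans ((Finset.card_union_le _ _).trans ?_)
    rw [Finset.card_range]
  have hcard' : (Nat.primeCounting n : ℝ) ≤
     ((Finset.range n).filter (fun q => q.Prime ∧ max g k < q)).card + (g+k+1) := by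
    exact_mod_cast hcard
  refine le_trans ?_ (h.trans hcard')
  have hlog : Real.log n = 2*r*Real.log g := by
    rw [hn]; push_cast; rw [Real.log_pow]; push_cast; ring
  have hg1 : (1:ℝ) < g := by exact_mod_cast (by omega : 1 < g)
  have hlg : 0 < Real.log g := Real.log_pos hg1
  have hlg2 : Real.log g ≤ g := (Real.log_le_sub_one_of_pos (by linarith)).trans (by linarith)
  have hrp : (0:ℝ) < r := by exact_mod_cast (by omega : 0 < r)
  have : ((g:ℝ)^(2*r)) = (n:ℝ) := by rw [hn]; push_cast; rfl
  rw [this, hlog]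
  apply div_le_div_of_nonneg_left (by positivity) (by positivity)
  nlinarith

theorem G_lower (g k K : ℕ) (hg : 2 ≤ g) (hK : 2 ≤ K) (hKg : g + 2*k + 1 ≤ K)
    (hKr : g*(4*K^170+1) ≤ 2^K) (G P : ℕ) 
    (hP : ((g:ℝ)^(2*(4*K^170))) / (4*(4*K^170:ℕ)*g) ≤ (P:ℝ) + (g+k+1))
    (hG : P ≤ k*(2*(4*K^170)*g+1)^k*g^(4*K^170) + G) :
    ((g:ℝ)^(4*K^170))^2 / (8*(4*K^170:ℕ)*g) ≤ G := by
  set r := 4*K^170 with hr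
  have hKr' : g * r + g ≤ 2^K := by nlinarith
  have key : (g+k+1 + k*(2*r*g+1)^k) * (8*r*g) ≤ g^r := by
    have a1 : 2*r*g+1 ≤ 2^(K+1) := by rw [pow_succ]; nlinarith
    have a2 : (2*r*g+1)^k ≤ 2^((K+1)*K) := by
      calc (2*r*g+1)^k ≤ (2^(K+1))^k := Nat.pow_le_pow_left a1 _
        _ = 2^((K+1)*k) := by rw [← pow_mul]
        _ ≤ _ := Nat.pow_le_pow_right (by norm_num) (Nat.mul_le_mul_left _ (by omega))
    have a3 : 8*r*g ≤ 2^(K+3) := by rw [pow_add]; nlinarith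
    have a4 : g+k+1 + k*(2*r*g+1)^k ≤ 2^K * 2^((K+1)*K) := by
      have b : K ≤ 2^K := Nat.lt_two_pow_self.le
      have c : 1 ≤ 2^((K+1)*K) := Nat.one_le_two_pow
      calc g+k+1 + k*(2*r*g+1)^k ≤ (g+k+1) * 2^((K+1)*K) + k * 2^((K+1)*K) := by
            gcongr
            exact Nat.le_mul_of_pos_right _ c
        _ = (g+2*k+1) * 2^((K+1)*K) := by ring
        _ ≤ _ := Nat.mul_le_mul_right _ (by omega)
    calc _ ≤ 2^K * 2^((K+1)*K) * 2^(K+3) := Nat.mul_le_mul a4 a3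
      _ = 2^(K + (K+1)*K + (K+3)) := by rw [← pow_add, ← pow_add]
      _ ≤ 2^r := by
        apply Nat.pow_le_pow_right (by norm_num)
        have d : K^3 ≤ K^170 := Nat.pow_le_pow_right (by omega) (by norm_num)
        have : K + (K+1)*K + (K+3) ≤ 4*K^3 := by nlinarith [sq_nonneg K, Nat.mul_le_mul hK hK, pow_pos (by omega : 0 < K) 2]
        omega
      _ ≤ g^r := Nat.pow_le_pow_left hg _
  have hr0 : 0 < r := by positivity
  have key' : ((g:ℝ)+k+1 + k*(2*r*g+1)^k) * (8*r*g) ≤ (g:ℝ)^r := by exact_mod_cast key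
  have hG' : (P:ℝ) ≤ k*(2*r*g+1)^k*(g:ℝ)^r + G := by exact_mod_cast hG
  have hgp : (0:ℝ) < g := by exact_mod_cast (by omega : 0 < g)
  have hrp : (0:ℝ) < r := by exact_mod_cast hr0
  set Y : ℝ := (g:ℝ)^r with hY
  have hY1 : (1:ℝ) ≤ Y := by
    rw [hY]; exact one_le_pow₀ (by exact_mod_cast (by omega : 1 ≤ g))
  have e : (g:ℝ)^(2*r) = Y^2 := by rw [hY, ← pow_mul, mul_comm]
  rw [e] at hP
  set M : ℝ := k*(2*r*g+1)^k with hM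
  have hM0 : 0 ≤ M := by positivity
  have f1 : ((g:ℝ)+k+1 + M) * Y ≤ Y^2 / (8*r*g) := by
    rw [le_div_iff₀ (by positivity)]
    nlinarith
  have f2 : Y^2 / (4*r*g) = Y^2/(8*r*g) + Y^2/(8*r*g) := by field_simp; norm_num
  have f3 : ((g:ℝ)+k+1) ≤ ((g:ℝ)+k+1) * Y := le_mul_of_one_le_right (by positivity) hY1
  rw [f2] at hP
  nlinarith

theorem final_contra (g k K : ℕ) (C : ℝ) (Y G : ℝ) (hg : 2 ≤ g) (hK : 2 ≤ K) (hC : 0 ≤ C)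
    (hY : (K:ℝ)^341 ≤ Y) (hG : Y^2 / (8*(4*K^170:ℕ)*g) ≤ G)
    (hG2 : G^2 ≤ Y * (k * (Y^2 + Y * (Y*g/(K:ℝ)^85) * (Y * C * (K:ℝ)^16/((K:ℝ)^153)^2))))
    (hbig : 1024*(g:ℝ)^2*(k + k*g*C) < K) : False := by
  have hK1 : (1:ℝ) ≤ K := by exact_mod_cast (by omega : 1 ≤ K)
  have hKpos : (0:ℝ) < K := by linarith
  have hgp : (0:ℝ) < g := by exact_mod_cast (by omega : 0 < g)
  have hYp : 0 < Y := lt_of_lt_of_le (by positivity) hY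
  have a : (Y^2 / (8*(4*K^170:ℕ)*g))^2 ≤ G^2 := by gcongr
  have b := a.trans hG2
  have c : (Y^2 / (8*(4*K^170:ℕ)*g))^2 = Y^4 / K^341 * (K / (1024 * g^2)) := by
    push_cast; field_simp; norm_num
  have d : Y * (k * (Y^2 + Y * (Y*g/(K:ℝ)^85) * (Y * C * (K:ℝ)^16/((K:ℝ)^153)^2)))
     = k * Y^3 + Y^4/K^341 * (k*g*C / K^34) := by
    field_simp
  rw [c, d] at b
  have e : k * Y^3 ≤ Y^4/K^341 * k := by
    rw [div_mul_eq_mul_div, le_div_iff₀ (by positivity)]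
    calc k * Y^3 * (K:ℝ)^341 ≤ k * Y^3 * Y := by gcongr
      _ = _ := by ring
  have f : k*g*C / (K:ℝ)^34 ≤ k*g*C := div_le_self (by positivity) (one_le_pow₀ hK1)
  have hp : 0 < Y^4/(K:ℝ)^341 := by positivity
  have h : Y^4/(K:ℝ)^341 * (K / (1024 * g^2)) ≤ Y^4/(K:ℝ)^341 * (k + k*g*C) := by
    rw [mul_add]
    have := mul_le_mul_of_nonneg_left f hp.le
    linarith
  have h2 := le_of_mul_le_mul_left h hp
  rw [div_le_iff₀ (by positivity)] at h2
  linarith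

theorem main_dsum (g k : ℕ) (hg : 2 ≤ g) : 
    ∃ q : Fin k → ℕ, (∀ i, Nat.Prime (q i)) ∧ StrictMono q ∧ (∀ i, max g k < q i) ∧
      StrictAnti (fun i => dsum g (q i)) := by
  by_contra hno
  obtain ⟨K1, hK1⟩ := growth_ev (Real.exp 20) 2754
  obtain ⟨K2, hK2⟩ := growth_ev (5*g) 170
  set C : ℝ := (Real.exp 12 / Real.log 2)^2 + 3 with hC
  obtain ⟨K3, hK3⟩ := exists_nat_gt (1024*(g:ℝ)^2*(k + k*g*C))
  obtain ⟨K, hKdef⟩ : ∃ K, K = K1 + K2 + K3 + g + 2*k + 2 := ⟨_, rfl⟩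
  have c1 := hK1 K (by omega)
  have c2 := hK2 K (by omega)
  have hK : 2 ≤ K := by omega
  have hKR : (1:ℝ) ≤ K := by exact_mod_cast (by omega : 1 ≤ K)
  have hKr : g*(4*K^170+1) ≤ 2^K := by
    have : 5*g*K^170 ≤ 2^K := by exact_mod_cast c2
    have h1 : 1 ≤ K^170 := Nat.one_le_pow _ _ (by omega)
    nlinarith
  have hg2 : (2:ℝ) ≤ g := by exact_mod_cast hg
  set Y : ℝ := (g:ℝ)^(4*K^170) with hY
  have hYp : 0 < Y := by positivity
  have hYK : (K:ℝ)^341 ≤ Y := by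
    calc (K:ℝ)^341 ≤ (K:ℝ)^2754 := pow_le_pow_right₀ hKR (by norm_num)
      _ ≤ Real.exp 20 * (K:ℝ)^2754 := le_mul_of_one_le_left (by positivity) (Real.one_le_exp (by norm_num))
      _ ≤ 2^K := c1
      _ ≤ 2^(4*K^170) := by
        apply pow_le_pow_right₀ (by norm_num)
        have : K ≤ K^170 := Nat.le_self_pow (by norm_num) K
        omega
      _ ≤ Y := pow_le_pow_left₀ (by norm_num) hg2 _
  have hr4 : 4 ≤ 4*K^170 := by
    have h1 : 1 ≤ K^170 := Nat.one_le_pow _ _ (by omega)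
    omega
  obtain ⟨G, hG1, hG2⟩ := windows g k (4*K^170) hg hno _ rfl
  have hP := PP_lower g k (4*K^170) hg hr4
  have hGl := G_lower g k K hg hK (by omega) hKr G _ hP hG1
  have hD0 : 0 ≤ Y * C * (K:ℝ)^16 / ((K:ℝ)^153)^2 := by positivity
  have hpc := pairs_count g (4*K^170) hg
    ((Finset.range (g^(2*(4*K^170)))).filter (fun q => q.Prime ∧ max g k < q))
    (fun q hq => by
      rw [Finset.mem_filter, Finset.mem_range] at hq
      exact ⟨hq.2.1, hq.1⟩)
    (Y * C * (K:ℝ)^16 / ((K:ℝ)^153)^2) (Y*g/(K:ℝ)^85)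
    (fun w => by
      have h := anticonc g hg (4*K^170) w
      have hKp : (0:ℝ) < K := by linarith
      refine (sq_le_sq₀ (Nat.cast_nonneg _) (by positivity)).1 ?_
      rw [div_pow, le_div_iff₀ (by positivity)]
      have e1 : ((K:ℝ)^85)^2 ≤ ((4*K^170 : ℕ):ℝ) + 1 := by
        push_cast
        have : (0:ℝ) < (K:ℝ)^170 := by positivity
        have e : ((K:ℝ)^85)^2 = (K:ℝ)^170 := by ring
        linarith
      refine (mul_le_mul_of_nonneg_left e1 (sq_nonneg _)).trans (h.trans ?_)
      have e2 : (g:ℝ)^(2*(4*K^170)+1) = Y^2 * g := by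
        rw [pow_succ, hY, ← pow_mul, mul_comm 2]
      rw [e2, mul_pow]
      have : (g:ℝ) ≤ (g:ℝ)^2 := by nlinarith
      gcongr)
    hD0
    (fun L1 h1 L2 h2 h12 => by
      refine le_trans (pair_bound g (4*K^170) (K^153) K (2*K^17) L1 L2 hg h1 h2 h12
        (Nat.one_le_pow _ _ (by omega)) ?_ (by omega) hKr (even_two_mul _)) 
        (D_bound g K hg hK c1)
      calc 2^(K^153) ≤ 2^(4*K^170) := by
            apply Nat.pow_le_pow_right (by norm_num)
            have : K^153 ≤ K^170 := Nat.pow_le_pow_right (by omega) (by norm_num)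
            omega
        _ ≤ _ := Nat.pow_le_pow_left hg _)
  refine final_contra g k K C Y G hg hK (by positivity) hYK hGl ?_ ?_
  · have hG3 := (Nat.cast_le (α := ℝ)).2 hG2
    rw [Nat.cast_pow, Nat.cast_mul, Nat.cast_mul, Nat.cast_pow] at hG3
    refine hG3.trans ?_
    have e : (g:ℝ)^(2*(4*K^170)) = Y^2 := by rw [hY, ← pow_mul, mul_comm]
    rw [e] at hpc
    exact mul_le_mul_of_nonneg_left (mul_le_mul_of_nonneg_left hpc (Nat.cast_nonneg _)) hYp.le
  · refine hK3.trans_le ?_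
    exact_mod_cast (by omega : K3 ≤ K)

theorem exists_primes_digitSum_decreasing (g : ℕ) (hg : 2 ≤ g) (k : ℕ) (hk : 1 ≤ k) :
    ∃ q : Fin k → ℕ, (∀ i, Nat.Prime (q i)) ∧ StrictMono q ∧
      (∀ i, max g k < q i) ∧
      StrictAnti (fun i => (Nat.digits g (q i)).sum) := by
  exact main_dsum g k hg
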